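/- arXiv:1004.3588 — 5 statements merged into one kernel-verified Lean document; each statement's English description precedes it below -/
import Mathlib

section
/- Let F be a finitely generated free group with free basis X, let φ ∈ Aut(F), and let u, v ∈ F. Let F′ = F * ⟨z⟩ be the free group on X together with one new generator z, let φ′ be the endomorphism of F′ that extends φ and sends z to u·z·u⁻¹, and let γ_v be the inner automorphism of F′ given by x ↦ v⁻¹·x·v. Then there exists g ∈ F with (gφ)⁻¹·u·g = v if and only if the fixed subgroup Fix(φ′γ_v) = {w ∈ F′ : w(φ′γ_v) = w} contains an element of the form g⁻¹·z·g with g ∈ F; moreover any such g satisfies (gφ)⁻¹·u·g = v. -/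
/-- The action of a group on itself by left multiplication, extended by a fixed point `none`. -/
def optionMulLeft (G : Type*) [Group G] : G →* Equiv.Perm (Option G) :=
  MonoidHom.mk' (fun g => (Equiv.mulLeft g).optionCongr) fun g h => by
    ext1 x
    cases x <;> simp [mul_assoc]

/-- Only the identity of `FreeGroup α` commutes with the additional generator of
`FreeGroup (Option α)`. -/
theorem FreeGroup.eq_one_of_commute_map_some_of_none {α : Type*} {h : FreeGroup α}
    (hc : Commute (FreeGroup.map some h) (FreeGroup.of (none : Option α))) : h = 1 := by
  classical
  let ρ : FreeGroup (Option α) →* Equiv.Perm (Option (FreeGroup α)) :=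
    FreeGroup.lift fun o => o.elim (Equiv.swap none (some 1))
      fun a => optionMulLeft _ (FreeGroup.of a)
  have hρ : ρ.comp (FreeGroup.map some) = optionMulLeft (FreeGroup α) := by
    ext1 a
    simp [ρ]
  have hρh : ρ (FreeGroup.map some h) = optionMulLeft _ h := DFunLike.congr_fun hρ h
  have hρz : ρ (FreeGroup.of none) = Equiv.swap none (some 1) := by simp [ρ]
  have key := DFunLike.congr_fun (hc.map ρ).eq none
  rw [hρh, hρz] at key
  simpa [optionMulLeft] using key


/-- Let `F` be a f.g. free group on basis `X`, `φ ∈ Aut(F)`, `u, v ∈ F`. Let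
`F' = F * ⟨z⟩` be the free group on `X ∪ {z}`, `φ'` the endomorphism of `F'` extending `φ`
with `zφ' = u z u⁻¹`, and `γ_v` conjugation by `v`. Then `u ∼_φ v` iff `Fix(φ'γ_v)`
contains an element of the form `g⁻¹ z g` with `g ∈ F`; moreover any such `g` is a valid
`φ`-twisted conjugating element. -/
theorem twisted_conj_iff_fixed_subgroup {α : Type*} [Finite α] (φ : MulAut (FreeGroup α))
    (u v : FreeGroup α) :
    let ι : FreeGroup α →* FreeGroup (Option α) := FreeGroup.map some
    let z : FreeGroup (Option α) := FreeGroup.of none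
    let φ' : FreeGroup (Option α) →* FreeGroup (Option α) :=
      FreeGroup.lift fun o : Option α =>
        o.elim (ι u * z * (ι u)⁻¹) fun a => ι (φ (FreeGroup.of a))
    ((∃ g : FreeGroup α, (φ g)⁻¹ * u * g = v) ↔
        ∃ g : FreeGroup α,
          (ι v)⁻¹ * φ' ((ι g)⁻¹ * z * ι g) * ι v = (ι g)⁻¹ * z * ι g) ∧
      ∀ g : FreeGroup α,
        (ι v)⁻¹ * φ' ((ι g)⁻¹ * z * ι g) * ι v = (ι g)⁻¹ * z * ι g →
          (φ g)⁻¹ * u * g = v := by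
  intro ι z φ'
  have hφ'z : φ' z = ι u * z * (ι u)⁻¹ := by simp [φ', z]
  have hφ'ι (g : FreeGroup α) : φ' (ι g) = ι (φ g) := by
    have : φ'.comp ι = ι.comp φ.toMonoidHom := by
      ext1 a
      simp [φ', ι]
    exact DFunLike.congr_fun this g
  have fixed_of_conj (g : FreeGroup α) (hg : (φ g)⁻¹ * u * g = v) :
      (ι v)⁻¹ * φ' ((ι g)⁻¹ * z * ι g) * ι v = (ι g)⁻¹ * z * ι g := by
    subst hg
    simp only [map_mul, map_inv, hφ'z, hφ'ι]
    group
  have conj_of_fixed (g : FreeGroup α)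
      (hg : (ι v)⁻¹ * φ' ((ι g)⁻¹ * z * ι g) * ι v = (ι g)⁻¹ * z * ι g) :
      (φ g)⁻¹ * u * g = v := by
    have hc : Commute (ι (g * v⁻¹ * (φ g)⁻¹ * u)) z := by
      simp only [map_mul, map_inv, hφ'z, hφ'ι] at hg
      rw [commute_iff_eq, ← mul_inv_eq_iff_eq_mul]
      simp only [map_mul, map_inv]
      calc _ = ι g * ((ι v)⁻¹ * ((ι (φ g))⁻¹ * (ι u * z * (ι u)⁻¹) * ι (φ g)) * ι v) *
            (ι g)⁻¹ := by group
        _ = z := by rw [hg]; group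
    have h1 := FreeGroup.eq_one_of_commute_map_some_of_none hc
    calc (φ g)⁻¹ * u * g = v * g⁻¹ * (g * v⁻¹ * (φ g)⁻¹ * u) * g := by group
      _ = v := by rw [h1]; group
  exact ⟨⟨fun ⟨g, hg⟩ => ⟨g, fixed_of_conj g hg⟩, fun ⟨g, hg⟩ => ⟨g, conj_of_fixed g hg⟩⟩,
    conj_of_fixed⟩
end

section
/- Let G and H be groups, let φ, ψ : G → H be homomorphisms, and let u, v ∈ H. Let Ĝ = G * ⟨z⟩ and Ĥ = H * ⟨z⟩ be the free products with an infinite cyclic group generated by z. Let φ̂ : Ĝ → Ĥ be the extension of φ with zφ̂ = u·z·u⁻¹, let ψ̂ : Ĝ → Ĥ be the extension of ψ with zψ̂ = z, and let φ̂^v : Ĝ → Ĥ be φ̂ followed by conjugation by v, i.e. gφ̂^v = v⁻¹·(gφ̂)·v. Then u and v are doubly-twisted conjugate with respect to (φ, ψ) if and only if there exists g ∈ G such that g⁻¹·z·g ∈ Eq(φ̂^v, ψ̂). -/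
open Monoid
open scoped Monoid.Coprod

/-- In `H ∗ ⟨z⟩` the only element of `H` commuting with `z` is `1`. -/
theorem eq_one_of_commute_inl_inr_ofAdd_one {H : Type*} [Group H] {h : H}
    (hc : Commute (Coprod.inl h : H ∗ Multiplicative ℤ)
      (Coprod.inr (Multiplicative.ofAdd 1))) : h = 1 := by
  classical
  let f : H ∗ Multiplicative ℤ →* Equiv.Perm (Option H) :=
    Coprod.lift (MulAction.toPermHom H (Option H))
      (zpowersHom _ (Equiv.swap none (some 1)))
  have hp := congrArg (fun σ : Equiv.Perm (Option H) => σ none) (hc.map f).eq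
  simpa [f] using hp

/-- Let `φ, ψ : G → H` be group homomorphisms and `u, v ∈ H`. Let `Ĝ = G * ⟨z⟩`,
`Ĥ = H * ⟨z⟩`, let `φ̂` extend `φ` with `zφ̂ = u z u⁻¹`, `ψ̂` extend `ψ` with `zψ̂ = z`,
and `φ̂^v = φ̂` followed by conjugation by `v`. Then `u` and `v` are doubly-twisted
conjugate w.r.t. `(φ, ψ)` iff there is `g ∈ G` with `g⁻¹ z g ∈ Eq(φ̂^v, ψ̂)`. -/
theorem doubly_twisted_iff_equalizer {G H : Type*} [Group G] [Group H]
    (φ ψ : G →* H) (u v : H) :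
    let zH : H ∗ Multiplicative ℤ := Coprod.inr (Multiplicative.ofAdd 1)
    let zG : G ∗ Multiplicative ℤ := Coprod.inr (Multiplicative.ofAdd 1)
    let φhat : G ∗ Multiplicative ℤ →* H ∗ Multiplicative ℤ :=
      Coprod.lift ((Coprod.inl : H →* H ∗ Multiplicative ℤ).comp φ)
        ((zpowersHom (H ∗ Multiplicative ℤ)) (Coprod.inl u * zH * (Coprod.inl u)⁻¹))
    let ψhat : G ∗ Multiplicative ℤ →* H ∗ Multiplicative ℤ :=
      Coprod.lift ((Coprod.inl : H →* H ∗ Multiplicative ℤ).comp ψ) Coprod.inr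
    ((∃ g : G, (φ g)⁻¹ * u * ψ g = v) ↔
      ∃ g : G,
        (Coprod.inl v)⁻¹ * φhat ((Coprod.inl g)⁻¹ * zG * Coprod.inl g) * Coprod.inl v =
          ψhat ((Coprod.inl g)⁻¹ * zG * Coprod.inl g)) := by
  intro zH zG φhat ψhat
  have hφ (g : G) : φhat ((Coprod.inl g)⁻¹ * zG * Coprod.inl g) =
      (Coprod.inl (φ g))⁻¹ * (Coprod.inl u * zH * (Coprod.inl u)⁻¹) * Coprod.inl (φ g) := by
    simp [φhat, zG]
  have hψ (g : G) : ψhat ((Coprod.inl g)⁻¹ * zG * Coprod.inl g) =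
      (Coprod.inl (ψ g))⁻¹ * zH * Coprod.inl (ψ g) := by
    simp [ψhat, zG, zH]
  refine exists_congr fun g => ?_
  rw [hφ, hψ]
  constructor
  · rintro rfl
    simp only [map_mul, map_inv]
    group
  · intro h
    have hc : Commute (Coprod.inl (ψ g * v⁻¹ * (φ g)⁻¹ * u) : H ∗ Multiplicative ℤ) zH := by
      have h' := congrArg
        (fun x => Coprod.inl (ψ g) * x * (Coprod.inl v)⁻¹ * (Coprod.inl (φ g))⁻¹ * Coprod.inl u) h
      simp only [Commute, SemiconjBy, map_mul, map_inv]
      simpa [mul_assoc] using h'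
    have hw := eq_one_of_commute_inl_inr_ofAdd_one hc
    calc (φ g)⁻¹ * u * ψ g = v * (ψ g)⁻¹ * (ψ g * v⁻¹ * (φ g)⁻¹ * u) * ψ g := by group
      _ = v := by rw [hw]; group
end

section
/- Let G be a free group with free basis a₁, …, aₙ and H a finitely generated free group, and let φ, ψ : G → H be homomorphisms. Let G*G be the free group on a₁, …, aₙ, a₁′, …, aₙ′ and let φ*ψ : G*G → H be the homomorphism with aᵢ ↦ aᵢφ and aᵢ′ ↦ aᵢψ. If φ*ψ has remnant, then (Gφ) ∩ (Gψ) = {1}; in particular Eq(φ, ψ) = {1}. -/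
/-- The number of letters cancelled in the product `u * v` of elements of a free group:
`c(u,v) = (|u| + |v| - |uv|)/2`. -/
def cancel {κ : Type*} [DecidableEq κ] (u v : FreeGroup κ) : ℕ :=
  (FreeGroup.norm u + FreeGroup.norm v - FreeGroup.norm (u * v)) / 2

/-- The basis letter indexed by `(i, ε)`: `of i` if `ε = true`, `(of i)⁻¹` if `ε = false`. -/
def bLetter {ι : Type*} (p : ι × Bool) : FreeGroup ι :=
  cond p.2 (FreeGroup.of p.1) (FreeGroup.of p.1)⁻¹

/-- `P_χ(x_i)`: maximal cancellation of `x_iχ` with the image of a basis letter `b ≠ x_i⁻¹`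
multiplied on the left. -/
def Pc {ι κ : Type*} [Fintype ι] [DecidableEq ι] [DecidableEq κ]
    (χ : FreeGroup ι →* FreeGroup κ) (i : ι) : ℕ :=
  (Finset.univ.erase (i, false)).sup fun p => cancel (χ (bLetter p)) (χ (FreeGroup.of i))

/-- `S_χ(x_i)`: maximal cancellation of `x_iχ` with the image of a basis letter `b ≠ x_i⁻¹`
multiplied on the right. -/
def Sc {ι κ : Type*} [Fintype ι] [DecidableEq ι] [DecidableEq κ]
    (χ : FreeGroup ι →* FreeGroup κ) (i : ι) : ℕ :=
  (Finset.univ.erase (i, false)).sup fun p => cancel (χ (FreeGroup.of i)) (χ (bLetter p))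

/-- `χ` has remnant if for every basis element a nontrivial subword of its image survives
all the cancellations: `P_χ(x_i) + S_χ(x_i) < |x_iχ|`. -/
def HasRemnant {ι κ : Type*} [Fintype ι] [DecidableEq ι] [DecidableEq κ]
    (χ : FreeGroup ι →* FreeGroup κ) : Prop :=
  ∀ i : ι, Pc χ i + Sc χ i < FreeGroup.norm (χ (FreeGroup.of i))

/-- The remnant length `|Rem_χ(x_i)| = |x_iχ| - P_χ(x_i) - S_χ(x_i)`. -/
def RemLen {ι κ : Type*} [Fintype ι] [DecidableEq ι] [DecidableEq κ]
    (χ : FreeGroup ι →* FreeGroup κ) (i : ι) : ℕ :=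
  FreeGroup.norm (χ (FreeGroup.of i)) - Pc χ i - Sc χ i

/-- The length of the longest common prefix of two lists. -/
def commonPrefixLength {α : Type*} [DecidableEq α] : List α → List α → ℕ
  | a :: l, b :: m => if a = b then commonPrefixLength l m + 1 else 0
  | _, _ => 0

theorem min_commonPrefixLength_le {α : Type*} [DecidableEq α] (l m k : List α) :
    min (commonPrefixLength l m) (commonPrefixLength m k) ≤ commonPrefixLength l k := by
  induction l generalizing m k with
  | nil => simp [commonPrefixLength]
  | cons a l ih =>
    cases m with
    | nil => simp [commonPrefixLength]
    | cons b m =>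
      cases k with
      | nil => simp [commonPrefixLength]
      | cons c k =>
        have := ih m k
        simp only [commonPrefixLength]
        grind

namespace FreeGroup

variable {κ : Type*} [DecidableEq κ]

theorem isReduced_invRev_append {a b : κ × Bool} {l m : List (κ × Bool)}
    (hl : IsReduced (a :: l)) (hm : IsReduced (b :: m)) (hab : a ≠ b) :
    IsReduced (invRev (a :: l) ++ b :: m) := by
  have hl' : IsReduced (invRev (a :: l)) := by
    rw [isReduced_iff_reduce_eq, reduce_invRev, hl.reduce_eq]
  refine List.IsChain.append hl' hm ?_
  intro x hx y hy hxy
  simp [invRev] at hx hy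
  subst hx hy
  obtain ⟨a, _ | _⟩ := a <;> obtain ⟨b, _ | _⟩ := b <;> simp_all

theorem norm_inv_mk_mul_mk {l m : List (κ × Bool)} (hl : IsReduced l) (hm : IsReduced m) :
    norm ((mk l)⁻¹ * mk m) + 2 * commonPrefixLength l m = l.length + m.length := by
  induction l generalizing m with
  | nil =>
    simp [commonPrefixLength, norm, ← one_eq_mk, hm.reduce_eq]
  | cons a l ih =>
    cases m with
    | nil =>
      simp only [← one_eq_mk, mul_one, norm_inv_eq]
      simp [commonPrefixLength, norm, hl.reduce_eq]
    | cons b m =>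
      by_cases hab : a = b
      · subst hab
        have key : (mk (a :: l))⁻¹ * mk (a :: m) = (mk l)⁻¹ * mk m := by
          rw [← List.singleton_append, ← mul_mk, ← List.singleton_append (l := m), ← mul_mk]
          group
        have := ih (m := m) (List.IsChain.tail hl) (List.IsChain.tail hm)
        rw [key]
        simp only [commonPrefixLength, if_true, List.length_cons]
        omega
      · rw [inv_mk, mul_mk, norm, toWord_mk, (isReduced_invRev_append hl hm hab).reduce_eq]
        simp [commonPrefixLength, hab]

theorem norm_inv_mul_add (u v : FreeGroup κ) :
    norm (u⁻¹ * v) + 2 * commonPrefixLength u.toWord v.toWord = norm u + norm v := by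
  simpa [norm, mk_toWord] using
    norm_inv_mk_mul_mk (isReduced_toWord (x := u)) (isReduced_toWord (x := v))

end FreeGroup

section Cancel

variable {κ : Type*} [DecidableEq κ]

theorem cancel_eq_commonPrefixLength (u v : FreeGroup κ) :
    cancel u v = commonPrefixLength u⁻¹.toWord v.toWord := by
  have := FreeGroup.norm_inv_mul_add u⁻¹ v
  rw [inv_inv, FreeGroup.norm_inv_eq] at this
  unfold cancel
  omega

theorem norm_mul_add_cancel (u v : FreeGroup κ) :
    FreeGroup.norm (u * v) + 2 * cancel u v = FreeGroup.norm u + FreeGroup.norm v := by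
  have := FreeGroup.norm_inv_mul_add u⁻¹ v
  rwa [inv_inv, FreeGroup.norm_inv_eq, ← cancel_eq_commonPrefixLength] at this

theorem min_cancel_le (u v w : FreeGroup κ) :
    min (cancel u v) (cancel v⁻¹ w) ≤ cancel u w := by
  simpa only [cancel_eq_commonPrefixLength, inv_inv] using min_commonPrefixLength_le _ _ _

theorem cancel_inv_inv (u v : FreeGroup κ) : cancel v⁻¹ u⁻¹ = cancel u v := by
  have h₁ := norm_mul_add_cancel u v
  have h₂ := norm_mul_add_cancel v⁻¹ u⁻¹
  rw [← mul_inv_rev] at h₂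
  simp only [FreeGroup.norm_inv_eq] at h₂
  omega

theorem cancel_inv_mul (u v : FreeGroup κ) :
    cancel u⁻¹ (u * v) + cancel u v = FreeGroup.norm u := by
  have h₁ := norm_mul_add_cancel u v
  have h₂ := norm_mul_add_cancel u⁻¹ (u * v)
  rw [inv_mul_cancel_left, FreeGroup.norm_inv_eq] at h₂
  omega

end Cancel

theorem bLetter_not {ι : Type*} (i : ι) (b : Bool) : bLetter (i, !b) = (bLetter (i, b))⁻¹ := by
  cases b <;> simp [bLetter]

theorem mk_cons_eq_bLetter_mul {ι : Type*} (p : ι × Bool) (l : List (ι × Bool)) :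
    FreeGroup.mk (p :: l) = bLetter p * FreeGroup.mk l := by
  rw [← List.singleton_append, ← FreeGroup.mul_mk]
  obtain ⟨i, _ | _⟩ := p <;> rfl

section Remnant

variable {ι κ : Type*} [Fintype ι] [DecidableEq ι] [DecidableEq κ]
  {χ : FreeGroup ι →* FreeGroup κ}

/-- The bound on the cancellation at the start of the image of a letter. -/
def startBound (χ : FreeGroup ι →* FreeGroup κ) (p : ι × Bool) : ℕ :=
  cond p.2 (Pc χ p.1) (Sc χ p.1)

/-- The bound on the cancellation at the end of the image of a letter. -/
def endBound (χ : FreeGroup ι →* FreeGroup κ) (p : ι × Bool) : ℕ :=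
  cond p.2 (Sc χ p.1) (Pc χ p.1)

theorem cancel_le_Pc {i : ι} {p : ι × Bool} (hp : p ≠ (i, false)) :
    cancel (χ (bLetter p)) (χ (FreeGroup.of i)) ≤ Pc χ i :=
  Finset.le_sup (f := fun p => cancel (χ (bLetter p)) (χ (FreeGroup.of i))) (by simp [hp])

theorem cancel_le_Sc {i : ι} {p : ι × Bool} (hp : p ≠ (i, false)) :
    cancel (χ (FreeGroup.of i)) (χ (bLetter p)) ≤ Sc χ i :=
  Finset.le_sup (f := fun p => cancel (χ (FreeGroup.of i)) (χ (bLetter p))) (by simp [hp])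

theorem cancel_le_endBound {p q : ι × Bool} (h : p.1 = q.1 → p.2 = q.2) :
    cancel (χ (bLetter p)) (χ (bLetter q)) ≤ endBound χ p := by
  obtain ⟨i, _ | _⟩ := p
  · obtain ⟨j, b⟩ := q
    have := cancel_le_Pc (χ := χ) (i := i) (p := (j, !b)) (by grind)
    rw [bLetter_not, ← cancel_inv_inv] at this
    simpa [endBound, bLetter] using this
  · exact cancel_le_Sc (by grind)

theorem cancel_le_startBound {p q : ι × Bool} (h : p.1 = q.1 → p.2 = q.2) :
    cancel (χ (bLetter p)) (χ (bLetter q)) ≤ startBound χ q := by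
  obtain ⟨i, _ | _⟩ := q
  · obtain ⟨j, b⟩ := p
    have := cancel_le_Sc (χ := χ) (i := i) (p := (j, !b)) (by grind)
    rw [bLetter_not, ← cancel_inv_inv] at this
    simpa [startBound, bLetter] using this
  · exact cancel_le_Pc (by grind)

namespace HasRemnant

theorem bounds_lt_norm (h : HasRemnant χ) (p : ι × Bool) :
    startBound χ p + endBound χ p < FreeGroup.norm (χ (bLetter p)) := by
  obtain ⟨i, _ | _⟩ := p
  · have := h i
    simp only [startBound, endBound, bLetter, cond_false, map_inv, FreeGroup.norm_inv_eq]
    omega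
  · exact h i

theorem cancel_mk_le_endBound (h : HasRemnant χ) {p : ι × Bool} {l : List (ι × Bool)}
    (hl : FreeGroup.IsReduced (p :: l)) :
    cancel (χ (bLetter p)) (χ (FreeGroup.mk l)) ≤ endBound χ p := by
  induction l generalizing p with
  | nil => simp [← FreeGroup.one_eq_mk, cancel]
  | cons q l ih =>
    rw [FreeGroup.isReduced_cons_cons] at hl
    have h₁ := ih hl.2
    have h₂ := cancel_le_endBound (χ := χ) hl.1
    have h₃ := cancel_le_startBound (χ := χ) hl.1
    have h₄ := h.bounds_lt_norm q
    have h₅ := cancel_inv_mul (χ (bLetter q)) (χ (FreeGroup.mk l))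
    have h₆ := min_cancel_le (χ (bLetter p)) (χ (bLetter q) * χ (FreeGroup.mk l)) (χ (bLetter q))
    have h₇ := cancel_inv_inv (χ (bLetter q))⁻¹ (χ (bLetter q) * χ (FreeGroup.mk l))
    rw [inv_inv] at h₇
    rw [mk_cons_eq_bLetter_mul, map_mul]
    omega

/-- A homomorphism of free groups with remnant is injective. -/
theorem injective (h : HasRemnant χ) : Function.Injective χ := by
  rw [injective_iff_map_eq_one]
  intro w hw
  rw [← FreeGroup.toWord_eq_nil_iff]
  have hred := FreeGroup.isReduced_toWord (x := w)
  rw [← FreeGroup.mk_toWord (x := w)] at hw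
  cases hl : w.toWord with
  | nil => rfl
  | cons p l =>
    rw [hl] at hred hw
    rw [mk_cons_eq_bLetter_mul, map_mul] at hw
    have h₁ := h.cancel_mk_le_endBound hred
    have h₂ := cancel_inv_mul (χ (bLetter p)) (χ (FreeGroup.mk l))
    have h₃ := h.bounds_lt_norm p
    rw [hw] at h₂
    simp [cancel] at h₁ h₂
    omega

end HasRemnant

end Remnant

/-- If `φ * ψ : G*G → H` (sending `aᵢ ↦ aᵢφ`, `aᵢ′ ↦ aᵢψ`) has remnant, then
`(Gφ) ∩ (Gψ) = {1}`; in particular `Eq(φ, ψ) = {1}`. -/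
theorem range_inter_trivial_of_remnant {n : ℕ} {κ : Type*} [Fintype κ] [DecidableEq κ]
    (φ ψ : FreeGroup (Fin n) →* FreeGroup κ)
    (h : HasRemnant ((FreeGroup.lift (Sum.elim (fun i => φ (FreeGroup.of i))
        (fun i => ψ (FreeGroup.of i)))) : FreeGroup (Fin n ⊕ Fin n) →* FreeGroup κ)) :
    Set.range ⇑φ ∩ Set.range ⇑ψ = {1} ∧ {g : FreeGroup (Fin n) | φ g = ψ g} = {1} := by
  have hinj := h.injective
  set χ : FreeGroup (Fin n ⊕ Fin n) →* FreeGroup κ := FreeGroup.lift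
    (Sum.elim (fun i => φ (FreeGroup.of i)) (fun i => ψ (FreeGroup.of i))) with hχ
  have hφ (g) : χ (FreeGroup.map Sum.inl g) = φ g := by
    refine DFunLike.congr_fun (f := χ.comp (FreeGroup.map Sum.inl)) (g := φ) ?_ g
    ext i; simp [hχ]
  have hψ (g) : χ (FreeGroup.map Sum.inr g) = ψ g := by
    refine DFunLike.congr_fun (f := χ.comp (FreeGroup.map Sum.inr)) (g := ψ) ?_ g
    ext i; simp [hχ]
  let ρ : FreeGroup (Fin n ⊕ Fin n) →* FreeGroup (Fin n) :=
    FreeGroup.lift (Sum.elim FreeGroup.of 1)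
  have hl (g) : ρ (FreeGroup.map Sum.inl g) = g := by
    refine DFunLike.congr_fun (f := ρ.comp (FreeGroup.map Sum.inl)) (g := MonoidHom.id _) ?_ g
    ext i; simp [ρ]
  have hr (g) : ρ (FreeGroup.map Sum.inr g) = 1 := by
    refine DFunLike.congr_fun (f := ρ.comp (FreeGroup.map Sum.inr)) (g := 1) ?_ g
    ext i; simp [ρ]
  have key {a b} (hab : φ a = ψ b) : a = 1 := by
    rw [← hφ, ← hψ] at hab
    rw [← hl a, hinj hab, hr]
  constructor
  · ext x
    simp only [Set.mem_inter_iff, Set.mem_range, Set.mem_singleton_iff]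
    constructor
    · rintro ⟨⟨a, rfl⟩, b, hb⟩
      rw [key hb.symm, map_one]
    · rintro rfl
      exact ⟨⟨1, map_one φ⟩, 1, map_one ψ⟩
  · ext x
    simp only [Set.mem_ofPred_eq, Set.mem_singleton_iff]
    exact ⟨key, by rintro rfl; simp⟩
end

section
/- Let G be a free group of rank greater than 1 with free basis a₁, …, aₙ, let φ be an endomorphism of G, and let u, v ∈ G. Let φ*u*v : G*ℤ*ℤ → G be the homomorphism on the free group with basis a₁,…,aₙ,b₁,b₂ sending aᵢ ↦ aᵢφ, b₁ ↦ u, b₂ ↦ v. If φ*u*v has remnant, then u and v lie in different φ-twisted conjugacy classes: there is no z ∈ G with v = (zφ)⁻¹·u·z. -/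
namespace FreeGroup

section Cancellation

variable {κ : Type*} [DecidableEq κ]

theorem norm_mk_of_isReduced {L : List (κ × Bool)} (h : IsReduced L) :
    norm (mk L) = L.length := by
  rw [norm, toWord_mk, h.reduce_eq]

theorem isReduced_invRev {L : List (κ × Bool)} (h : IsReduced L) : IsReduced (invRev L) := by
  rw [isReduced_iff_reduce_eq, reduce_invRev, h.reduce_eq]

theorem isReduced_invRev_cons_append_cons {a b : κ × Bool} {L₁ L₂ : List (κ × Bool)}
    (h₁ : IsReduced (a :: L₁)) (h₂ : IsReduced (b :: L₂)) (hab : a ≠ b) :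
    IsReduced (invRev (a :: L₁) ++ b :: L₂) := by
  refine List.isChain_append.2 ⟨isReduced_invRev h₁, h₂, fun x hx y hy => ?_⟩
  simp only [invRev, List.map_cons, List.reverse_cons, List.getLast?_concat, Option.mem_def,
    Option.some.injEq, List.head?_cons] at hx hy
  subst hx hy
  intro h
  by_contra hne
  exact hab (Prod.ext h (by simpa using hne))

/-- Cancellation between `L₁⁻¹` and `L₂` is the longest common prefix of `L₁` and `L₂`. -/
theorem exists_longest_common_prefix :
    ∀ {L₁ L₂ : List (κ × Bool)}, IsReduced L₁ → IsReduced L₂ →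
      ∃ q, q <+: L₁ ∧ q <+: L₂ ∧
        L₁.length + L₂.length = norm ((mk L₁)⁻¹ * mk L₂) + 2 * q.length ∧
        ∀ p, p <+: L₁ → p <+: L₂ → p.length ≤ q.length
  | [], L₂, _, h₂ => by
    refine ⟨[], List.nil_prefix, List.nil_prefix, ?_, fun p hp _ => by simpa using hp⟩
    simp [← one_eq_mk, norm_mk_of_isReduced h₂]
  | a :: L₁, [], h₁, _ => by
    refine ⟨[], List.nil_prefix, List.nil_prefix, ?_, fun p _ hp => by simpa using hp⟩
    rw [← one_eq_mk, mul_one, norm_inv_eq, norm_mk_of_isReduced h₁]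
    simp
  | a :: L₁, b :: L₂, h₁, h₂ => by
    by_cases hab : a = b
    · subst hab
      obtain ⟨q, hq₁, hq₂, hq, hmax⟩ := exists_longest_common_prefix
        (h₁.infix (List.suffix_cons a L₁).isInfix) (h₂.infix (List.suffix_cons a L₂).isInfix)
      refine ⟨a :: q, by simpa using hq₁, by simpa using hq₂, ?_, fun p hp₁ hp₂ => ?_⟩
      · have hmk (L : List (κ × Bool)) : mk (a :: L) = mk [a] * mk L := by simp [mul_mk]
        rw [hmk L₁, hmk L₂, show (mk [a] * mk L₁)⁻¹ * (mk [a] * mk L₂) = (mk L₁)⁻¹ * mk L₂ by group]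
        simp only [List.length_cons]
        omega
      · cases p with
        | nil => simp
        | cons c p =>
          rw [List.cons_prefix_cons] at hp₁ hp₂
          simpa using hmax p hp₁.2 hp₂.2
    · refine ⟨[], List.nil_prefix, List.nil_prefix, ?_, fun p hp₁ hp₂ => ?_⟩
      · rw [inv_mk, mul_mk, norm_mk_of_isReduced (isReduced_invRev_cons_append_cons h₁ h₂ hab)]
        simp
      · cases p with
        | nil => simp
        | cons c p =>
          rw [List.cons_prefix_cons] at hp₁ hp₂
          exact absurd (hp₁.1.symm.trans hp₂.1) hab

theorem exists_prefix_cancel (u v : FreeGroup κ) :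
    ∃ q, q <+: u.toWord ∧ q <+: v.toWord ∧ cancel u⁻¹ v = q.length ∧
      norm u + norm v = norm (u⁻¹ * v) + 2 * cancel u⁻¹ v ∧
      ∀ p, p <+: u.toWord → p <+: v.toWord → p.length ≤ q.length := by
  obtain ⟨q, hq₁, hq₂, hq, hmax⟩ :=
    exists_longest_common_prefix (isReduced_toWord (x := u)) (isReduced_toWord (x := v))
  rw [mk_toWord, mk_toWord] at hq
  change norm u + norm v = _ at hq
  have hc : cancel u⁻¹ v = q.length := by
    rw [cancel, norm_inv_eq]
    omega
  exact ⟨q, hq₁, hq₂, hc, by rw [hc, hq], hmax⟩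

theorem norm_add_norm_eq (u v : FreeGroup κ) :
    norm u + norm v = norm (u * v) + 2 * cancel u v := by
  obtain ⟨-, -, -, -, h, -⟩ := exists_prefix_cancel u⁻¹ v
  simpa using h

theorem cancel_inv_inv (u v : FreeGroup κ) : cancel v⁻¹ u⁻¹ = cancel u v := by
  rw [cancel, cancel, ← mul_inv_rev, norm_inv_eq, norm_inv_eq, norm_inv_eq, add_comm]

/-- The cancellation form is `0`-hyperbolic. -/
theorem min_cancel_le (u v w : FreeGroup κ) :
    min (cancel u v) (cancel v⁻¹ w) ≤ cancel u w := by
  obtain ⟨p, hp₁, hp₂, hp, -⟩ := exists_prefix_cancel u⁻¹ v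
  obtain ⟨q, hq₁, hq₂, hq, -⟩ := exists_prefix_cancel v w
  obtain ⟨r, -, -, hr, -, hmax⟩ := exists_prefix_cancel u⁻¹ w
  rw [inv_inv] at hp hr
  rw [hp, hq, hr]
  rcases le_total p.length q.length with h | h
  · rw [min_eq_left h]
    exact hmax p hp₁ ((List.prefix_of_prefix_length_le hp₂ hq₁ h).trans hq₂)
  · rw [min_eq_right h]
    exact hmax q ((List.prefix_of_prefix_length_le hq₁ hp₂ h).trans hp₁) hq₂

end Cancellation

section Remnant

variable {ι κ : Type*} [DecidableEq κ]

theorem mk_cons_eq_bLetter_mul (p : ι × Bool) (L : List (ι × Bool)) :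
    mk (p :: L) = bLetter p * mk L := by
  rcases p with ⟨i, _ | _⟩ <;> simp [bLetter, of, mul_mk, inv_mk, invRev]

theorem bLetter_inv (i : ι) (ε : Bool) : (bLetter (i, ε))⁻¹ = bLetter (i, !ε) := by
  cases ε <;> simp [bLetter]

/-- If every letter keeps a nonempty part of its image under cancellation with its neighbours,
then a reduced word beginning with `p` has an image which is long and shares with the image of
`p` everything that cannot be cancelled from the right. -/
theorem norm_map_mk_cons_of_remnant (χ : FreeGroup ι →* FreeGroup κ) (P S : ι × Bool → ℕ)
    (hPS : ∀ p, P p + S p < norm (χ (bLetter p)))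
    (hcancel : ∀ p q : ι × Bool, (p.1 = q.1 → p.2 = q.2) →
      cancel (χ (bLetter p)) (χ (bLetter q)) ≤ S p ∧
        cancel (χ (bLetter p)) (χ (bLetter q)) ≤ P q) :
    ∀ (p : ι × Bool) (L : List (ι × Bool)), IsReduced (p :: L) →
      L.length + norm (χ (bLetter p)) ≤ norm (χ (mk (p :: L))) + S p ∧
        norm (χ (bLetter p)) ≤ cancel (χ (bLetter p))⁻¹ (χ (mk (p :: L))) + S p
  | p, [], _ => by
    rw [mk_cons_eq_bLetter_mul, ← one_eq_mk, mul_one]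
    have h := norm_add_norm_eq (χ (bLetter p))⁻¹ (χ (bLetter p))
    rw [inv_mul_cancel, norm_one, norm_inv_eq] at h
    simp only [List.length_nil]
    omega
  | p, q :: L, hL => by
    obtain ⟨hpq, hL'⟩ := isReduced_cons_cons.1 hL
    obtain ⟨ih₁, ih₂⟩ := norm_map_mk_cons_of_remnant χ P S hPS hcancel q L hL'
    obtain ⟨hS, hP⟩ := hcancel p q hpq
    have hq := hPS q
    rw [mk_cons_eq_bLetter_mul p, _root_.map_mul]
    set X := χ (bLetter p)
    set Y := χ (bLetter q)
    set W := χ (mk (q :: L))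
    have hyp : min (cancel X W) (cancel W⁻¹ Y) ≤ cancel X Y := min_cancel_le X W Y
    have hWY : cancel W⁻¹ Y = cancel Y⁻¹ W := by simpa using cancel_inv_inv Y⁻¹ W
    have hXW := norm_add_norm_eq X W
    have hXXW := norm_add_norm_eq X⁻¹ (X * W)
    rw [inv_mul_cancel_left, norm_inv_eq] at hXXW
    simp only [List.length_cons]
    omega

theorem length_le_norm_map_mk_of_hasRemnant [Fintype ι] [DecidableEq ι]
    {χ : FreeGroup ι →* FreeGroup κ} (h : HasRemnant χ) {L : List (ι × Bool)}
    (hL : IsReduced L) : L.length ≤ norm (χ (mk L)) := by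
  have hPc (i : ι) (p : ι × Bool) (hp : p ≠ (i, false)) :
      cancel (χ (bLetter p)) (χ (of i)) ≤ Pc χ i :=
    Finset.le_sup (f := fun p => cancel (χ (bLetter p)) (χ (of i))) (by simpa using hp)
  have hSc (i : ι) (p : ι × Bool) (hp : p ≠ (i, false)) :
      cancel (χ (of i)) (χ (bLetter p)) ≤ Sc χ i :=
    Finset.le_sup (f := fun p => cancel (χ (of i)) (χ (bLetter p))) (by simpa using hp)
  cases L with
  | nil => simp
  | cons p L =>
    let P : ι × Bool → ℕ := fun p => cond p.2 (Pc χ p.1) (Sc χ p.1)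
    let S : ι × Bool → ℕ := fun p => cond p.2 (Sc χ p.1) (Pc χ p.1)
    have hPS (p : ι × Bool) : P p + S p < norm (χ (bLetter p)) := by
      rcases p with ⟨i, _ | _⟩
      · simpa [P, S, bLetter, add_comm] using h i
      · simpa [P, S, bLetter] using h i
    have key := norm_map_mk_cons_of_remnant χ P S hPS ?_ p L hL
    · have := hPS p
      simp only [List.length_cons]
      omega
    · rintro ⟨i, ε⟩ ⟨j, δ⟩ hij
      have hflip : cancel (χ (bLetter (i, ε))) (χ (bLetter (j, δ))) =
          cancel (χ (bLetter (j, !δ))) (χ (bLetter (i, !ε))) := by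
        rw [← bLetter_inv, ← bLetter_inv, _root_.map_inv, _root_.map_inv, cancel_inv_inv]
      constructor
      · cases ε with
        | true => exact hSc i (j, δ) (by grind)
        | false =>
          rw [hflip]
          exact hPc i (j, !δ) (by grind)
      · cases δ with
        | true => exact hPc j (i, ε) (by grind)
        | false =>
          rw [hflip]
          exact hSc j (i, !ε) (by grind)

end Remnant

end FreeGroup

/-- Corollary 3.9: let `G` be a free group of rank `> 1`, `φ` an endomorphism of `G`, and
`u, v ∈ G`. If `φ*u*v : G*ℤ*ℤ → G` (sending `aᵢ ↦ aᵢφ`, `b₁ ↦ u`, `b₂ ↦ v`) has remnant,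
then `u` and `v` lie in different `φ`-twisted conjugacy classes. -/
theorem twisted_classes_differ_of_remnant {n : ℕ} (hn : 1 < n)
    (φ : FreeGroup (Fin n) →* FreeGroup (Fin n)) (u v : FreeGroup (Fin n))
    (φbar : FreeGroup (Fin n ⊕ Bool) →* FreeGroup (Fin n))
    (hφbar : φbar = FreeGroup.lift (Sum.elim (fun i => φ (FreeGroup.of i))
        (fun b => cond b v u)))
    (hrem : HasRemnant φbar) :
    ¬ ∃ z : FreeGroup (Fin n), (φ z)⁻¹ * u * z = v := by
  rintro ⟨z, hz⟩
  have hmap : φbar (FreeGroup.map Sum.inl z) = φ z := by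
    have : φbar.comp (FreeGroup.map Sum.inl) = φ := by
      ext i
      simp [hφbar]
    exact DFunLike.congr_fun this z
  set M : List ((Fin n ⊕ Bool) × Bool) := z.toWord.map fun p => (Sum.inl p.1, p.2) with hM
  have hMmk : FreeGroup.mk M = FreeGroup.map Sum.inl z := by
    conv_rhs => rw [← FreeGroup.mk_toWord (x := z), FreeGroup.map.mk]
  have hMred : FreeGroup.IsReduced M := by
    rw [hM, FreeGroup.IsReduced, List.isChain_map]
    simpa [FreeGroup.IsReduced] using FreeGroup.isReduced_toWord (x := z)
  have hred : FreeGroup.IsReduced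
      ((Sum.inr false, false) :: (M ++ [(Sum.inr true, true)])) := by
    refine List.isChain_cons.2 ⟨fun y hy => ?_, List.isChain_append.2
      ⟨hMred, List.isChain_singleton _, fun x hx y hy => ?_⟩⟩
    · rcases List.mem_append.1 (List.mem_of_mem_head? hy) with hy | hy
      · obtain ⟨p, -, rfl⟩ := List.mem_map.1 hy
        simp
      · simp [List.mem_singleton.1 hy]
    · obtain ⟨p, -, rfl⟩ := List.mem_map.1 (List.mem_of_mem_getLast? hx)
      obtain rfl : (Sum.inr true, true) = y := by simpa using hy
      simp
  have himage : φbar (FreeGroup.mk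
      ((Sum.inr false, false) :: (M ++ [(Sum.inr true, true)]))) = z := by
    rw [FreeGroup.mk_cons_eq_bLetter_mul, ← FreeGroup.mul_mk, hMmk,
      FreeGroup.mk_cons_eq_bLetter_mul, ← FreeGroup.one_eq_mk, mul_one, map_mul, map_mul, hmap,
      hφbar, ← hz]
    simp [bLetter]
    group
  have hlen := FreeGroup.length_le_norm_map_mk_of_hasRemnant hrem hred
  rw [himage, FreeGroup.norm] at hlen
  simp [hM] at hlen
end

section
/- (Mihailova's subgroup) Let Fₙ be the free group on s₁, …, sₙ, let R₁, …, Rₘ ∈ Fₙ, let N be the normal closure of {R₁, …, Rₘ} in Fₙ, and let π : Fₙ → H := Fₙ/N be the quotient homomorphism. Then the subgroup A = {(x, y) ∈ Fₙ × Fₙ : π(x) = π(y)} of Fₙ × Fₙ is generated by the elements (1, R₁), …, (1, Rₘ), (s₁, s₁), …, (sₙ, sₙ). -/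
/-- A subgroup of `G × G` containing the diagonal of a generating set contains the diagonal. -/
theorem Subgroup.diag_mem_of_closure_eq_top {G : Type*} [Group G] {S : Set G}
    (hS : Subgroup.closure S = ⊤) {K : Subgroup (G × G)} (hK : ∀ s ∈ S, (s, s) ∈ K) (x : G) :
    (x, x) ∈ K := by
  have h : Subgroup.closure S ≤ K.comap ((MonoidHom.id G).prod (MonoidHom.id G)) :=
    (Subgroup.closure_le _).2 hK
  exact h (hS ▸ Subgroup.mem_top x)

/-- If a subgroup `K` of `G × G` contains the diagonal, then the elements `y` with `(1, y) ∈ K`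
form a normal subgroup, so they include the normal closure of any set of such elements. -/
theorem Subgroup.one_prod_mem_of_mem_normalClosure {G : Type*} [Group G] {K : Subgroup (G × G)}
    (hdiag : ∀ x : G, (x, x) ∈ K) {S : Set G} (hS : ∀ r ∈ S, ((1 : G), r) ∈ K) {y : G}
    (hy : y ∈ Subgroup.normalClosure S) : ((1 : G), y) ∈ K := by
  have hnormal : (K.comap (MonoidHom.inr G G)).Normal := by
    refine ⟨fun y hy g => ?_⟩
    simpa using K.mul_mem (K.mul_mem (hdiag g) hy) (K.inv_mem (hdiag g))
  exact Subgroup.normalClosure_le_normal (N := K.comap (MonoidHom.inr G G)) hS hy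


/-- Mihailova's subgroup: let `Fₙ` be the free group on `s₁, …, sₙ`, `R₁, …, Rₘ ∈ Fₙ`,
`N` the normal closure of `{R₁, …, Rₘ}`, and `π : Fₙ → Fₙ/N` the quotient map. Then the
subgroup `A = {(x, y) : π x = π y}` of `Fₙ × Fₙ` is generated by
`(1, R₁), …, (1, Rₘ), (s₁, s₁), …, (sₙ, sₙ)`. -/
theorem mihailova_subgroup_generators {n m : ℕ} (R : Fin m → FreeGroup (Fin n)) :
    (Subgroup.closure
        ((Set.range fun j : Fin m => ((1 : FreeGroup (Fin n)), R j)) ∪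
          (Set.range fun i : Fin n => (FreeGroup.of i, FreeGroup.of i))) :
        Set (FreeGroup (Fin n) × FreeGroup (Fin n))) =
      {p : FreeGroup (Fin n) × FreeGroup (Fin n) |
        QuotientGroup.mk' (Subgroup.normalClosure (Set.range R)) p.1 =
          QuotientGroup.mk' (Subgroup.normalClosure (Set.range R)) p.2} := by
  set N := Subgroup.normalClosure (Set.range R)
  let A := MonoidHom.eqLocus
    ((QuotientGroup.mk' N).comp (MonoidHom.fst (FreeGroup (Fin n)) (FreeGroup (Fin n))))
    ((QuotientGroup.mk' N).comp (MonoidHom.snd (FreeGroup (Fin n)) (FreeGroup (Fin n))))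
  apply Set.Subset.antisymm
  · refine (Subgroup.closure_le A).2 ?_
    rintro _ (⟨j, rfl⟩ | ⟨i, rfl⟩)
    · exact QuotientGroup.eq.2
        (by simpa using Subgroup.subset_normalClosure (Set.mem_range_self j))
    · rfl
  · rintro ⟨x, y⟩ hxy
    set K := Subgroup.closure ((Set.range fun j : Fin m => ((1 : FreeGroup (Fin n)), R j)) ∪
      (Set.range fun i : Fin n => (FreeGroup.of i, FreeGroup.of i)))
    have hdiag : ∀ z, (z, z) ∈ K :=
      Subgroup.diag_mem_of_closure_eq_top (FreeGroup.closure_range_of _) <| by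
        rintro _ ⟨i, rfl⟩
        exact Subgroup.subset_closure (Or.inr ⟨i, rfl⟩)
    have hone : ((1 : FreeGroup (Fin n)), x⁻¹ * y) ∈ K := by
      refine Subgroup.one_prod_mem_of_mem_normalClosure hdiag ?_ (QuotientGroup.eq.1 hxy)
      rintro _ ⟨j, rfl⟩
      exact Subgroup.subset_closure (Or.inl ⟨j, rfl⟩)
    simpa using K.mul_mem (hdiag x) hone
end
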